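/- Let k be an algebraically closed field, let Λ be a finite-dimensional k-algebra, and let V be a finitely generated Λ-module with End_Λ(V) ≅ k and dim_k Ext¹_Λ(V,V) = 1. Suppose there exists a non-split short exact sequence of Λ-modules 0 → V →^ι M →^τ V → 0 such that Ext¹_Λ(M,V) = 0 and every surjective Λ-module homomorphism σ : M → V has kernel equal to ι(V). Then V has a universal deformation ring and R(Λ,V) ≅ k[t]/(t²). -/

import Mathlib

open IsLocalRing

section DeformationTheory

variable (k : Type) [Field k] (Λ : Type) [Ring Λ] [Algebra k Λ]
variable (V : Type) [AddCommGroup V] [Module k V] [Module Λ V] [IsScalarTower k Λ V]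

/-- A lift of the `Λ`-module `V` over a complete local commutative Noetherian `k`-algebra `R`
with residue field `k`: a finitely generated `R ⊗_k Λ`-module `M` (encoded as a type with
commuting `R`- and `Λ`-actions restricting to the same `k`-action) which is free over `R`,
together with a `Λ`-module isomorphism `k ⊗_R M ≅ V` (encoded as a surjective `Λ`-linear map
`π : M → V` whose kernel is `m_R M`). -/
structure ModuleLift (R : Type) [CommRing R] [Algebra k R] [IsLocalRing R] : Type 1 where
  carrier : Type
  [isAddCommGroup : AddCommGroup carrier]
  [isModuleBase : Module R carrier]
  [isModulek : Module k carrier]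
  [isModuleA : Module Λ carrier]
  [isTowerBase : IsScalarTower k R carrier]
  [isTowerA : IsScalarTower k Λ carrier]
  [isSMulComm : SMulCommClass R Λ carrier]
  [isFinite : Module.Finite R carrier]
  [isFree : Module.Free R carrier]
  π : carrier →ₗ[Λ] V
  π_surjective : Function.Surjective π
  π_ker : ∀ x : carrier, π x = 0 ↔ x ∈ (maximalIdeal R) • (⊤ : Submodule R carrier)

attribute [instance] ModuleLift.isAddCommGroup ModuleLift.isModuleBase ModuleLift.isModulek
  ModuleLift.isModuleA ModuleLift.isTowerBase ModuleLift.isTowerA ModuleLift.isSMulComm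
  ModuleLift.isFinite ModuleLift.isFree

variable {k Λ V}

/-- `L` represents the deformation obtained from the lift `U` by base change along `α`,
i.e. `L ≅ R ⊗_{A,α} U` as lifts of `V` over `R`.  This is encoded by the existence of an
`α`-semilinear, `Λ`-equivariant map `g : U → L` compatible with the reductions to `V` whose
image generates `L` over `R`. -/
def IsPushforward {A R : Type} [CommRing A] [Algebra k A] [IsLocalRing A]
    [CommRing R] [Algebra k R] [IsLocalRing R] (α : A →ₐ[k] R)
    (U : ModuleLift k Λ V A) (L : ModuleLift k Λ V R) : Prop :=
  ∃ g : U.carrier →+ L.carrier,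
    (∀ (a : A) (u : U.carrier), g (a • u) = α a • g u) ∧
    (∀ (l : Λ) (u : U.carrier), g (l • u) = l • g u) ∧
    Submodule.span R (Set.range g) = ⊤ ∧
    ∀ u : U.carrier, L.π (g u) = U.π u

/-- The lift `U` of `V` over `A` is universal: for every complete local commutative Noetherian
`k`-algebra `R` with residue field `k` and every lift `L` of `V` over `R` there is a unique
local `k`-algebra homomorphism `α : A → R` (automatically inducing the identity on residue
fields) such that `L` is the base change of `U` along `α`. -/
def IsUniversalLift (A : Type) [CommRing A] [Algebra k A] [IsLocalRing A]
    (U : ModuleLift k Λ V A) : Prop :=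
  ∀ (R : Type) [CommRing R] [Algebra k R] [IsLocalRing R] [IsNoetherianRing R],
    ∀ [IsAdicComplete (maximalIdeal R) R],
    Function.Bijective ((residue R).comp (algebraMap k R)) →
    ∀ L : ModuleLift k Λ V R,
      ∃! α : A →ₐ[k] R, IsLocalHom α ∧ IsPushforward α U L

variable (k Λ V)

/-- `A` is the universal deformation ring `R(Λ,V)`: it is a complete local commutative
Noetherian `k`-algebra with residue field `k`, and it carries a universal lift of `V`. -/
structure IsUniversalDeformationRing (A : Type) [CommRing A] [Algebra k A] : Prop where
  [isLocalRing : IsLocalRing A]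
  isNoetherianRing : IsNoetherianRing A
  isAdicComplete : IsAdicComplete (maximalIdeal A) A
  residue_bijective : Function.Bijective ((residue A).comp (algebraMap k A))
  exists_universalLift : ∃ U : ModuleLift k Λ V A, IsUniversalLift A U

/-- `End_Λ(V) ≅ k`: every `Λ`-endomorphism of `V` is multiplication by a unique scalar. -/
def EndIsScalar : Prop :=
  ∀ f : V →ₗ[Λ] V, ∃! c : k, ∀ v : V, f v = c • v

/-- An extension `0 → V → E → W → 0` of `Λ`-modules. -/
structure ModExtension (W : Type) [AddCommGroup W] [Module Λ W] : Type 1 where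
  middle : Type
  [isAddCommGroup : AddCommGroup middle]
  [isModule : Module Λ middle]
  ι : V →ₗ[Λ] middle
  p : middle →ₗ[Λ] W
  ι_injective : Function.Injective ι
  p_surjective : Function.Surjective p
  exact : ∀ x : middle, p x = 0 ↔ x ∈ Set.range ι

attribute [instance] ModExtension.isAddCommGroup ModExtension.isModule

variable {k Λ V}

/-- The extension splits. -/
def ModExtension.Splits {W : Type} [AddCommGroup W] [Module Λ W]
    (E : ModExtension Λ V W) : Prop :=
  ∃ s : W →ₗ[Λ] E.middle, ∀ w : W, E.p (s w) = w

variable (k Λ V)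

/-- `Ext¹_Λ(W,V) = 0`: every extension of `W` by `V` splits. -/
def ExtVanishes (W : Type) [AddCommGroup W] [Module Λ W] : Prop :=
  ∀ E : ModExtension Λ V W, E.Splits

/-- `dim_k Ext¹_Λ(V,V) = 1`: there is a non-split self-extension of `V`, and any two
non-split self-extensions are proportional (the class of one is a nonzero scalar multiple
of the class of the other). -/
def ExtSelfOneDimensional : Prop :=
  (∃ E : ModExtension Λ V V, ¬ E.Splits) ∧
  ∀ E₁ E₂ : ModExtension Λ V V, ¬ E₁.Splits → ¬ E₂.Splits →
    ∃ c : k, c ≠ 0 ∧ ∃ f : E₁.middle ≃ₗ[Λ] E₂.middle,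
      (∀ v : V, f (E₁.ι v) = E₂.ι (c • v)) ∧ ∀ x : E₁.middle, E₂.p (f x) = E₁.p x

/-- The endomorphism `f` of `V` agrees with `c • id` up to an endomorphism factoring
through a projective `Λ`-module. -/
def IsStablyScalar (c : k) (f : V →ₗ[Λ] V) : Prop :=
  ∃ (P : ModuleCat.{0} Λ) (g : V →ₗ[Λ] P) (h : P →ₗ[Λ] V),
    Module.Projective Λ P ∧ ∀ v : V, f v = c • v + h (g v)

/-- The stable endomorphism ring of `V` is isomorphic to `k`: modulo endomorphisms factoring
through projective modules, every endomorphism is a unique scalar. -/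
def StableEndIsoK : Prop :=
  (∀ f : V →ₗ[Λ] V, ∃ c : k, IsStablyScalar k Λ V c f) ∧
  (∀ c : k, IsStablyScalar k Λ V c 0 → c = 0)

end DeformationTheory

section LocalLinearAlgebra

variable {R A B C : Type*} [CommRing R] [AddCommGroup A] [Module R A]
  [AddCommGroup B] [Module R B] [AddCommGroup C] [Module R C]

theorem map_mem_ideal_smul_top (φ : A →ₗ[R] B) {I : Ideal R} {a : A}
    (ha : a ∈ I • (⊤ : Submodule R A)) : φ a ∈ I • (⊤ : Submodule R B) :=
  Submodule.smul_top_le_comap_smul_top I φ ha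

theorem mem_ideal_smul_range (φ : A →ₗ[R] B) {I : Ideal R} {a : A}
    (ha : a ∈ I • (⊤ : Submodule R A)) : φ a ∈ I • LinearMap.range φ := by
  rw [← Submodule.map_top, ← Submodule.map_smul'']
  exact Submodule.mem_map_of_mem ha

variable [IsLocalRing R]

theorem one_tmul_residueField_eq_zero_iff (b : B) :
    TensorProduct.mk R (ResidueField R) B 1 b = 0 ↔
      b ∈ maximalIdeal R • (⊤ : Submodule R B) := by
  rw [← LinearMap.mem_ker]
  exact SetLike.ext_iff.1 (LinearMap.ker_tensorProductMk (Q := B) (I := maximalIdeal R)) b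

/-- A linear map to a finite free module over a local ring that is injective modulo the maximal
ideal has a retraction. -/
theorem exists_leftInverse_of_mem_smul_top [Module.Finite R B] [Module.Finite R C]
    [Module.Free R C] (φ : B →ₗ[R] C)
    (h : ∀ b, φ b ∈ maximalIdeal R • (⊤ : Submodule R C) →
      b ∈ maximalIdeal R • (⊤ : Submodule R B)) :
    ∃ ψ : C →ₗ[R] B, ψ ∘ₗ φ = LinearMap.id := by
  rw [IsLocalRing.split_injective_iff_lTensor_residueField_injective,
    injective_iff_map_eq_zero]
  intro x hx
  obtain ⟨b, rfl⟩ : ∃ b, TensorProduct.mk R (ResidueField R) B 1 b = x :=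
    TensorProduct.mk_surjective R B (ResidueField R) residue_surjective x
  exact (one_tmul_residueField_eq_zero_iff b).2
    (h b ((one_tmul_residueField_eq_zero_iff (φ b)).1 hx))

/-- If a complex `A → B → C` of modules over a local ring, with `B` and `C` finite free, is exact
at `B` modulo the maximal ideal, then the image and the kernel of `A → B` are direct summands. -/
theorem exists_projections_of_exact_mod [Module.Finite R B] [Module.Free R B]
    [Module.Finite R C] [Module.Free R C] (f : A →ₗ[R] B) (g : B →ₗ[R] C)
    (hgf : ∀ a, g (f a) = 0)
    (hex : ∀ b, g b ∈ maximalIdeal R • (⊤ : Submodule R C) →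
      ∃ a, b - f a ∈ maximalIdeal R • (⊤ : Submodule R B)) :
    (∃ ρ : B →ₗ[R] LinearMap.range f, ∀ y : LinearMap.range f, ρ y = y) ∧
    (∃ q : A →ₗ[R] LinearMap.ker f, ∀ a : LinearMap.ker f, q a = a) := by
  set I := LinearMap.range f with hI
  have hIg : I ≤ LinearMap.ker g := by
    rintro _ ⟨a, rfl⟩
    exact hgf a
  have hI0 : ∀ b ∈ I, I.mkQ b = 0 := fun b hb => (Submodule.Quotient.mk_eq_zero I).2 hb
  obtain ⟨ψ, hψ⟩ := exists_leftInverse_of_mem_smul_top (I.liftQ g hIg) (by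
    intro b hb
    obtain ⟨b, rfl⟩ := I.mkQ_surjective b
    obtain ⟨a, ha⟩ := hex b hb
    have h1 : I.mkQ b = I.mkQ (b - f a) := by
      rw [map_sub, hI0 _ ⟨a, rfl⟩, sub_zero]
    rw [h1]
    exact map_mem_ideal_smul_top _ ha)
  have hproj : Module.Projective R (B ⧸ I) := Module.Projective.of_split _ ψ hψ
  obtain ⟨s, hs⟩ := Module.projective_lifting_property I.mkQ LinearMap.id I.mkQ_surjective
  have hs' : ∀ b, b - s (I.mkQ b) ∈ I := fun b => by
    rw [← Submodule.Quotient.mk_eq_zero, ← Submodule.mkQ_apply, map_sub, sub_eq_zero]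
    exact (LinearMap.congr_fun hs (I.mkQ b)).symm
  let ρ : B →ₗ[R] I := (LinearMap.id - s ∘ₗ I.mkQ).codRestrict I hs'
  have hρ : ∀ y : I, ρ y = y := fun y => by
    ext
    simp [ρ, hI0 _ y.2]
  refine ⟨⟨ρ, hρ⟩, ?_⟩
  have hprojI : Module.Projective R I := Module.Projective.of_split I.subtype ρ
    (LinearMap.ext hρ)
  obtain ⟨t, ht⟩ := Module.projective_lifting_property f.rangeRestrict LinearMap.id
    f.surjective_rangeRestrict
  have ht' : ∀ y : I, f (t y) = y := fun y => congrArg Subtype.val (LinearMap.congr_fun ht y)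
  have ht0 : ∀ a, a - t (f.rangeRestrict a) ∈ LinearMap.ker f := fun a => by
    rw [LinearMap.mem_ker, map_sub, ht', sub_eq_zero]
    rfl
  refine ⟨(LinearMap.id - t ∘ₗ f.rangeRestrict).codRestrict _ ht0, fun a => ?_⟩
  apply Subtype.ext
  have : f.rangeRestrict (a : A) = 0 := Subtype.ext a.2
  simp [this]

/-- If a complex `A → B → C` over a local ring, with `B` and `C` finite free, is exact at `B`
modulo the maximal ideal, then formation of the kernel of `A → B` commutes with reduction. -/
theorem ker_reduction_of_exact_mod [Module.Finite R A] [Module.Finite R B] [Module.Free R B]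
    [Module.Finite R C] [Module.Free R C] (f : A →ₗ[R] B) (g : B →ₗ[R] C)
    (hgf : ∀ a, g (f a) = 0)
    (hex : ∀ b, g b ∈ maximalIdeal R • (⊤ : Submodule R C) →
      ∃ a, b - f a ∈ maximalIdeal R • (⊤ : Submodule R B)) :
    (LinearMap.ker f).FG ∧
    (∀ a, f a ∈ maximalIdeal R • (⊤ : Submodule R B) →
      ∃ a' ∈ LinearMap.ker f, a - a' ∈ maximalIdeal R • (⊤ : Submodule R A)) ∧
    (∀ a ∈ LinearMap.ker f, a ∈ maximalIdeal R • (⊤ : Submodule R A) →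
      a ∈ maximalIdeal R • LinearMap.ker f) := by
  obtain ⟨⟨ρ, hρ⟩, q, hq⟩ := exists_projections_of_exact_mod f g hgf hex
  refine ⟨?_, fun a ha => ?_, fun a ha ham => ?_⟩
  · have : Module.Finite R (LinearMap.ker f) :=
      Module.Finite.of_surjective q fun a => ⟨a, hq a⟩
    exact Module.Finite.iff_fg.1 this
  · have h1 : f a ∈ maximalIdeal R • LinearMap.range f := by
      have := mem_ideal_smul_range ((LinearMap.range f).subtype ∘ₗ ρ) ha
      have h2 : ((LinearMap.range f).subtype ∘ₗ ρ) (f a) = f a :=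
        congrArg Subtype.val (hρ ⟨f a, a, rfl⟩)
      rw [h2] at this
      refine Submodule.smul_mono le_rfl ?_ this
      rintro _ ⟨b, rfl⟩
      exact (ρ b).2
    rw [← Submodule.map_top, ← Submodule.map_smul''] at h1
    obtain ⟨a'', ha'', h⟩ := h1
    exact ⟨a - a'', by rw [LinearMap.mem_ker, map_sub, h, sub_self], by simpa using ha''⟩
  · have := mem_ideal_smul_range ((LinearMap.ker f).subtype ∘ₗ q) ham
    have h2 : ((LinearMap.ker f).subtype ∘ₗ q) a = a := congrArg Subtype.val (hq ⟨a, ha⟩)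
    rw [h2] at this
    refine Submodule.smul_mono le_rfl ?_ this
    rintro _ ⟨b, rfl⟩
    exact (q b).2

end LocalLinearAlgebra

section Extensions

variable {Λ : Type} [Ring Λ] {V M P₀ P₁ : Type} [AddCommGroup V] [Module Λ V]
  [AddCommGroup M] [Module Λ M] [AddCommGroup P₀] [Module Λ P₀] [AddCommGroup P₁] [Module Λ P₁]

theorem exists_comp_eq_of_ker_le {Λ A B C : Type*} [Ring Λ] [AddCommGroup A] [Module Λ A]
    [AddCommGroup B] [Module Λ B] [AddCommGroup C] [Module Λ C] (p : A →ₗ[Λ] B)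
    (hp : Function.Surjective p) (f : A →ₗ[Λ] C) (hf : ∀ x, p x = 0 → f x = 0) :
    ∃ f' : B →ₗ[Λ] C, f' ∘ₗ p = f := by
  refine ⟨(LinearMap.ker p).liftQ f hf ∘ₗ (p.quotKerEquivOfSurjective hp).symm.toLinearMap,
    LinearMap.ext fun x => ?_⟩
  change (LinearMap.ker p).liftQ f hf ((p.quotKerEquivOfSurjective hp).symm (p x)) = f x
  rw [← LinearMap.quotKerEquivOfSurjective_apply_mk (hf := hp), LinearEquiv.symm_apply_apply]
  rfl

/-- If `Ext¹(M, V) = 0` and `P₁ → P₀ → M → 0` is exact, then every map `P₁ → V` that vanishes on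
the kernel of `P₁ → P₀` extends along `P₁ → P₀`. -/
theorem ExtVanishes.exists_extension (hExt : ExtVanishes Λ V M) (d : P₁ →ₗ[Λ] P₀)
    (ε : P₀ →ₗ[Λ] M) (hε : Function.Surjective ε)
    (hexact : ∀ x, ε x = 0 ↔ x ∈ LinearMap.range d) (φ : P₁ →ₗ[Λ] V)
    (hφ : ∀ y, d y = 0 → φ y = 0) : ∃ ψ : P₀ →ₗ[Λ] V, ∀ y, ψ (d y) = φ y := by
  let W : Submodule Λ (V × P₀) := LinearMap.range ((-φ).prod d)
  let p : (V × P₀) ⧸ W →ₗ[Λ] M := W.liftQ (ε ∘ₗ LinearMap.snd Λ V P₀) (by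
    rintro _ ⟨y, rfl⟩
    exact (hexact (d y)).2 ⟨y, rfl⟩)
  let i : V →ₗ[Λ] (V × P₀) ⧸ W := W.mkQ ∘ₗ LinearMap.inl Λ V P₀
  have hrel : ∀ y, W.mkQ (0, d y) = i (φ y) := fun y => by
    refine (Submodule.Quotient.eq W).2 ⟨y, ?_⟩
    simp
  have hi : Function.Injective i := by
    rw [injective_iff_map_eq_zero]
    intro v hv
    obtain ⟨y, hy⟩ := (Submodule.Quotient.mk_eq_zero W).1 hv
    have h1 : -φ y = v := congrArg Prod.fst hy
    have h2 : d y = 0 := congrArg Prod.snd hy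
    rw [← h1, hφ y h2, neg_zero]
  have hpi : ∀ x, p x = 0 ↔ x ∈ Set.range i := by
    intro x
    constructor
    · obtain ⟨⟨v, x⟩, rfl⟩ := W.mkQ_surjective x
      intro hx
      obtain ⟨y, rfl⟩ := (hexact x).1 hx
      refine ⟨v + φ y, ?_⟩
      rw [map_add, ← hrel]
      exact (map_add W.mkQ (v, 0) (0, d y)).symm.trans (by simp)
    · rintro ⟨v, rfl⟩
      exact map_zero ε
  obtain ⟨s, hs⟩ := hExt
    { middle := (V × P₀) ⧸ W
      ι := i
      p := p
      ι_injective := hi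
      p_surjective := fun m => by
        obtain ⟨x, rfl⟩ := hε m
        exact ⟨W.mkQ (0, x), rfl⟩
      exact := hpi }
  let u : P₀ →ₗ[Λ] (V × P₀) ⧸ W := W.mkQ ∘ₗ LinearMap.inr Λ V P₀ - s ∘ₗ ε
  have hu : ∀ x, u x ∈ LinearMap.range i := fun x => by
    refine (hpi _).1 ?_
    have h1 : p (s (ε x)) = ε x := hs (ε x)
    have h2 : p (W.mkQ (0, x)) = ε x := rfl
    simp only [u, LinearMap.sub_apply, LinearMap.comp_apply, LinearMap.inr_apply, map_sub, h2]
    rw [h1, sub_self]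
  refine ⟨(LinearEquiv.ofInjective i hi).symm.toLinearMap ∘ₗ u.codRestrict _ hu, fun y => ?_⟩
  rw [LinearMap.comp_apply, LinearEquiv.coe_coe, LinearEquiv.symm_apply_eq]
  apply Subtype.ext
  have h0 : ε (d y) = 0 := (hexact _).2 ⟨y, rfl⟩
  simp only [LinearMap.codRestrict_apply, LinearEquiv.ofInjective_apply, u, LinearMap.sub_apply,
    LinearMap.comp_apply, LinearMap.inr_apply, h0, map_zero, sub_zero]
  exact hrel y

/-- An extension whose inclusion admits a retraction splits. -/
theorem ModExtension.splits_of_retraction (E : ModExtension Λ V M) (r : E.middle →ₗ[Λ] V)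
    (hr : ∀ v, r (E.ι v) = v) : E.Splits := by
  obtain ⟨s, hs⟩ := exists_comp_eq_of_ker_le E.p E.p_surjective (LinearMap.id - E.ι ∘ₗ r)
    fun x hx => by
      obtain ⟨v, rfl⟩ := (E.exact x).1 hx
      simp [hr]
  refine ⟨s, fun w => ?_⟩
  obtain ⟨x, rfl⟩ := E.p_surjective w
  have h1 : s (E.p x) = x - E.ι (r x) := LinearMap.congr_fun hs x
  rw [h1, map_sub, (E.exact _).2 ⟨_, rfl⟩, sub_zero]

/-- If `End_Λ(V) = k`, then for a non-split self-extension `E` of `V` every map from the middle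
term to `V` is a multiple of the projection. -/
theorem ModExtension.exists_eq_smul_p {k : Type} [Field k] [Algebra k Λ] [Module k V]
    [IsScalarTower k Λ V] (hEnd : EndIsScalar k Λ V) (E : ModExtension Λ V V) (hE : ¬ E.Splits)
    (σ : E.middle →ₗ[Λ] V) : ∃ c : k, ∀ x, σ x = c • E.p x := by
  obtain ⟨c, hc, -⟩ := hEnd (σ ∘ₗ E.ι)
  have hc0 : c = 0 := by
    by_contra hne
    refine hE (E.splits_of_retraction (c⁻¹ • σ) fun v => ?_)
    have h1 : σ (E.ι v) = c • v := hc v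
    rw [LinearMap.smul_apply, h1, inv_smul_smul₀ hne]
  obtain ⟨σ', hσ'⟩ := exists_comp_eq_of_ker_le E.p E.p_surjective σ fun x hx => by
    obtain ⟨v, rfl⟩ := (E.exact x).1 hx
    refine (hc v).trans ?_
    rw [hc0, zero_smul]
  obtain ⟨d, hd, -⟩ := hEnd σ'
  exact ⟨d, fun x => (LinearMap.congr_fun hσ' x).symm.trans (hd _)⟩

theorem EndIsScalar.nontrivial {k : Type} [Field k] [Algebra k Λ] [Module k V]
    [IsScalarTower k Λ V] (hEnd : EndIsScalar k Λ V) : Nontrivial V := by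
  by_contra h
  have : Subsingleton V := not_nontrivial_iff_subsingleton.1 h
  obtain ⟨c, -, hc⟩ := hEnd 0
  exact zero_ne_one ((hc 0 fun _ => Subsingleton.elim _ _).trans
    (hc 1 fun _ => Subsingleton.elim _ _).symm)

end Extensions

section HomModules

variable {R Λ L : Type*} [CommRing R] [Ring Λ] [AddCommGroup L] [Module R L] [Module Λ L]
  [SMulCommClass Λ R L]

theorem finite_hom_pi [Module.Finite R L] (n : ℕ) :
    Module.Finite R ((Fin n → Λ) →ₗ[Λ] L) :=
  Module.Finite.equiv ((Pi.basisFun Λ (Fin n)).constr R)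

theorem free_hom_pi [Module.Free R L] (n : ℕ) :
    Module.Free R ((Fin n → Λ) →ₗ[Λ] L) :=
  Module.Free.of_equiv ((Pi.basisFun Λ (Fin n)).constr R)

theorem apply_mem_ideal_smul_top {P : Type*} [AddCommGroup P] [Module Λ P] {I : Ideal R}
    {φ : P →ₗ[Λ] L} (hφ : φ ∈ I • (⊤ : Submodule R (P →ₗ[Λ] L))) (x : P) :
    φ x ∈ I • (⊤ : Submodule R L) :=
  map_mem_ideal_smul_top (LinearMap.applyₗ' R x) hφ

theorem hom_pi_mem_ideal_smul_top {n : ℕ} {I : Ideal R} {φ : (Fin n → Λ) →ₗ[Λ] L}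
    (hφ : ∀ x, φ x ∈ I • (⊤ : Submodule R L)) :
    φ ∈ I • (⊤ : Submodule R ((Fin n → Λ) →ₗ[Λ] L)) := by
  classical
  let e := (Pi.basisFun Λ (Fin n)).constr (M' := L) R
  have h1 : φ = e (∑ j, LinearMap.single R (fun _ => L) j (φ (Pi.basisFun Λ (Fin n) j))) := by
    have h2 : ∑ j, LinearMap.single R (fun _ => L) j (φ (Pi.basisFun Λ (Fin n) j)) =
        fun j => φ (Pi.basisFun Λ (Fin n) j) := Finset.univ_sum_single _
    rw [h2]
    exact (e.apply_symm_apply φ).symm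
  rw [h1]
  refine map_mem_ideal_smul_top e.toLinearMap (Submodule.sum_mem _ fun j _ => ?_)
  exact map_mem_ideal_smul_top _ (hφ _)

/-- Precomposition with a `Λ`-linear map, as an `R`-linear map. -/
def precomp (R L : Type*) [CommRing R] [AddCommGroup L] [Module R L] [Module Λ L]
    [SMulCommClass Λ R L] {P Q : Type*} [AddCommGroup P] [Module Λ P]
    [AddCommGroup Q] [Module Λ Q] (d : P →ₗ[Λ] Q) : (Q →ₗ[Λ] L) →ₗ[R] (P →ₗ[Λ] L) where
  toFun φ := φ ∘ₗ d
  map_add' _ _ := rfl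
  map_smul' _ _ := rfl

end HomModules

section LiftingHoms

variable {R Λ V M L : Type} [CommRing R] [IsLocalRing R] [Ring Λ] [IsNoetherianRing Λ]
  [AddCommGroup V] [Module Λ V] [AddCommGroup M] [Module Λ M] [Module.Finite Λ M]
  [AddCommGroup L] [Module R L] [Module Λ L] [SMulCommClass Λ R L] [Module.Finite R L]
  [Module.Free R L]

/-- If `L` is finite free over `R` with reduction `V` and `Ext¹_Λ(M, V) = 0`, then `Hom_Λ(M, L)`
is finitely generated over `R` and its reduction is `Hom_Λ(M, V)`. -/
theorem ExtVanishes.hom_reduction (hExt : ExtVanishes Λ V M) (π : L →ₗ[Λ] V)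
    (hπ : Function.Surjective π)
    (hker : ∀ x, π x = 0 ↔ x ∈ maximalIdeal R • (⊤ : Submodule R L)) :
    Module.Finite R (M →ₗ[Λ] L) ∧
    (∀ τ : M →ₗ[Λ] V, ∃ g : M →ₗ[Λ] L, π ∘ₗ g = τ) ∧
    (∀ h : M →ₗ[Λ] L, π ∘ₗ h = 0 →
      h ∈ maximalIdeal R • (⊤ : Submodule R (M →ₗ[Λ] L))) := by
  obtain ⟨n₀, ε, hε⟩ := Module.Finite.exists_fin' Λ M
  obtain ⟨n₁, d₁', hd₁'⟩ := Module.Finite.exists_fin' Λ (LinearMap.ker ε)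
  let d₁ := (LinearMap.ker ε).subtype ∘ₗ d₁'
  obtain ⟨n₂, d₂', hd₂'⟩ := Module.Finite.exists_fin' Λ (LinearMap.ker d₁)
  let d₂ := (LinearMap.ker d₁).subtype ∘ₗ d₂'
  have hex₀ : ∀ x, ε x = 0 ↔ x ∈ LinearMap.range d₁ := fun x => by
    constructor
    · intro hx
      obtain ⟨y, hy⟩ := hd₁' ⟨x, hx⟩
      exact ⟨y, congrArg Subtype.val hy⟩
    · rintro ⟨y, rfl⟩
      exact (d₁' y).2
  have hex₁ : ∀ x, d₁ x = 0 ↔ x ∈ LinearMap.range d₂ := fun x => by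
    constructor
    · intro hx
      obtain ⟨y, hy⟩ := hd₂' ⟨x, hx⟩
      exact ⟨y, congrArg Subtype.val hy⟩
    · rintro ⟨y, rfl⟩
      exact (d₂' y).2
  have fin (n) := finite_hom_pi (R := R) (Λ := Λ) (L := L) n
  have free (n) := free_hom_pi (R := R) (Λ := Λ) (L := L) n
  obtain ⟨hfg, hlift, hred⟩ := ker_reduction_of_exact_mod (precomp R L d₁) (precomp R L d₂)
    (fun a => LinearMap.ext fun x => by
      have h0 : d₁ (d₂ x) = 0 := (hex₁ _).2 ⟨x, rfl⟩
      change a (d₁ (d₂ x)) = 0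
      rw [h0, map_zero])
    (fun b hb => by
      obtain ⟨ψ, hψ⟩ := hExt.exists_extension d₁ ε hε hex₀ (π ∘ₗ b) (fun y hy => by
        obtain ⟨z, rfl⟩ := (hex₁ y).1 hy
        exact (hker _).2 (apply_mem_ideal_smul_top hb z))
      obtain ⟨a, rfl⟩ := Module.projective_lifting_property π ψ hπ
      refine ⟨a, hom_pi_mem_ideal_smul_top fun x => (hker _).1 ?_⟩
      change π (b x - a (d₁ x)) = 0
      rw [map_sub, sub_eq_zero]
      exact (hψ x).symm)
  have hinj : Function.Injective (precomp R L ε) := fun a b hab => by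
    refine LinearMap.ext fun m => ?_
    obtain ⟨x, rfl⟩ := hε m
    exact LinearMap.congr_fun hab x
  have hfactor : ∀ a ∈ LinearMap.ker (precomp R L d₁), ∃ g, precomp R L ε g = a := by
    intro a ha
    obtain ⟨g, hg⟩ := exists_comp_eq_of_ker_le ε hε a fun x hx => by
      obtain ⟨y, rfl⟩ := (hex₀ x).1 hx
      exact LinearMap.congr_fun ha y
    exact ⟨g, hg⟩
  have hrange : LinearMap.range (precomp R L ε) = LinearMap.ker (precomp R L d₁) := by
    refine le_antisymm ?_ hfactor
    rintro _ ⟨g, rfl⟩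
    refine LinearMap.ext fun y => ?_
    have h0 : ε (d₁ y) = 0 := (hex₀ _).2 ⟨y, rfl⟩
    change g (ε (d₁ y)) = 0
    rw [h0, map_zero]
  refine ⟨?_, fun τ => ?_, fun h hh => ?_⟩
  · rw [← hrange] at hfg
    have := Module.Finite.iff_fg.2 hfg
    exact Module.Finite.equiv (LinearEquiv.ofInjective (precomp R L ε) hinj).symm
  · obtain ⟨a, ha⟩ := Module.projective_lifting_property π (τ ∘ₗ ε) hπ
    obtain ⟨a', ha', hsub⟩ := hlift a (hom_pi_mem_ideal_smul_top fun y => (hker _).1 (by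
      have h0 : ε (d₁ y) = 0 := (hex₀ _).2 ⟨y, rfl⟩
      refine (LinearMap.congr_fun ha (d₁ y)).trans ?_
      rw [LinearMap.comp_apply, h0, map_zero]))
    obtain ⟨g, rfl⟩ := hfactor a' ha'
    refine ⟨g, LinearMap.ext fun m => ?_⟩
    obtain ⟨x, rfl⟩ := hε m
    have h1 := (hker _).2 (apply_mem_ideal_smul_top hsub x)
    rw [LinearMap.sub_apply, map_sub, sub_eq_zero] at h1
    exact h1.symm.trans (LinearMap.congr_fun ha x)
  · have h1 := hred (precomp R L ε h) (hrange ▸ ⟨h, rfl⟩)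
      (hom_pi_mem_ideal_smul_top fun x => (hker _).1 (LinearMap.congr_fun hh (ε x)))
    rw [← hrange, ← Submodule.map_top, ← Submodule.map_smul''] at h1
    obtain ⟨h', hh', heq⟩ := h1
    rwa [← hinj heq]

/-- If moreover `Hom_Λ(M, V)` is generated by the reduction of `g`, in the sense that every map
`M → V` is the reduction of a multiple of `g`, then `g` generates `Hom_Λ(M, L)`. -/
theorem ExtVanishes.exists_eq_smul (hExt : ExtVanishes Λ V M) (π : L →ₗ[Λ] V)
    (hπ : Function.Surjective π)
    (hker : ∀ x, π x = 0 ↔ x ∈ maximalIdeal R • (⊤ : Submodule R L)) (g : M →ₗ[Λ] L)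
    (hg : ∀ σ : M →ₗ[Λ] V, ∃ r : R, π ∘ₗ (r • g) = σ) (h : M →ₗ[Λ] L) :
    ∃ r : R, h = r • g := by
  obtain ⟨hfin, -, hred⟩ := hExt.hom_reduction π hπ hker
  have hle : (⊤ : Submodule R (M →ₗ[Λ] L)) ≤ Submodule.span R {g} := by
    refine Submodule.le_of_le_smul_of_le_jacobson_bot Module.Finite.fg_top
      (IsLocalRing.maximalIdeal_le_jacobson ⊥) fun h _ => ?_
    obtain ⟨r, hr⟩ := hg (π ∘ₗ h)
    have : h - r • g ∈ maximalIdeal R • (⊤ : Submodule R (M →ₗ[Λ] L)) :=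
      hred _ (by rw [LinearMap.comp_sub, hr, sub_self])
    rw [← add_sub_cancel (r • g) h]
    exact Submodule.add_mem_sup (Submodule.smul_mem _ _ (Submodule.mem_span_singleton_self g)) this
  obtain ⟨r, hr⟩ := Submodule.mem_span_singleton.1 (hle (Submodule.mem_top (x := h)))
  exact ⟨r, hr.symm⟩

end LiftingHoms

section DualNumbers

open Polynomial

theorem isAdicComplete_of_pow_eq_bot {R : Type*} [CommRing R] (I : Ideal R) {n : ℕ}
    (hI : I ^ n = ⊥) : IsAdicComplete I R where
  haus' x hx := by
    have := hx n
    rwa [hI, Submodule.bot_smul, SModEq.bot] at this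
  prec' f hf := by
    refine ⟨f n, fun m => ?_⟩
    rcases le_total m n with h | h
    · exact hf h
    · have := hf h
      rw [hI, Submodule.bot_smul, SModEq.bot] at this
      rw [this]

variable (k : Type) [Field k]

/-- The ring `k[t]/(t²)`. -/
abbrev DualQuot : Type := k[X] ⧸ Ideal.span {(X : k[X]) ^ 2}

namespace DualQuot

/-- The class of `t` in `k[t]/(t²)`. -/
noncomputable def t : DualQuot k := Ideal.Quotient.mk _ X

theorem t_sq : t k ^ 2 = 0 :=
  Ideal.Quotient.eq_zero_iff_mem.2 (Ideal.mem_span_singleton_self _)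

variable {k}

theorem exists_eq (a : DualQuot k) : ∃ c d : k, a = algebraMap k _ c + d • t k := by
  obtain ⟨p, rfl⟩ := Ideal.Quotient.mk_surjective a
  refine ⟨p.coeff 0, p.divX.coeff 0, ?_⟩
  have h1 : p = C (p.coeff 0) + C (p.divX.coeff 0) * X + p.divX.divX * X ^ 2 := by
    conv_lhs => rw [← p.divX_mul_X_add, ← p.divX.divX_mul_X_add]
    ring
  have h2 : Ideal.Quotient.mk (Ideal.span {(X : k[X]) ^ 2}) (X ^ 2) = 0 := t_sq k
  conv_lhs => rw [h1, map_add, map_mul _ p.divX.divX, h2, mul_zero, add_zero, map_add, map_mul]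
  exact congrArg₂ (· + ·) rfl (Algebra.smul_def (p.divX.coeff 0) (t k)).symm

/-- The `k`-algebra map out of `k[t]/(t²)` sending `t` to an element of square zero. -/
noncomputable def lift {B : Type*} [Ring B] [Algebra k B] (b : B) (hb : b ^ 2 = 0) :
    DualQuot k →ₐ[k] B :=
  Ideal.Quotient.liftₐ _ (aeval b) fun p hp => by
    obtain ⟨q, rfl⟩ := Ideal.mem_span_singleton'.1 hp
    simp [hb]

@[simp]
theorem lift_t {B : Type*} [Ring B] [Algebra k B] (b : B) (hb : b ^ 2 = 0) :
    lift b hb (t k) = b :=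
  aeval_X b

theorem algHom_ext {B : Type*} [Ring B] [Algebra k B] {α β : DualQuot k →ₐ[k] B}
    (h : α (t k) = β (t k)) : α = β := by
  refine AlgHom.ext fun a => ?_
  obtain ⟨c, d, rfl⟩ := exists_eq a
  simp [h]

variable (k) in
/-- The augmentation of `k[t]/(t²)`. -/
noncomputable def ev : DualQuot k →ₐ[k] k := lift 0 (zero_pow two_ne_zero)

theorem ev_eq (c d : k) : ev k (algebraMap k _ c + d • t k) = c := by
  simp [ev]

theorem sq_eq_zero_of_ev_eq_zero {a : DualQuot k} (ha : ev k a = 0) : a ^ 2 = 0 := by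
  obtain ⟨c, d, rfl⟩ := exists_eq a
  rw [ev_eq] at ha
  rw [ha, map_zero, zero_add, _root_.smul_pow, t_sq, smul_zero]

instance isLocalHom_ev : IsLocalHom (ev k) where
  map_nonunit a ha := by
    have h1 : IsNilpotent (a - algebraMap k _ (ev k a)) :=
      ⟨2, sq_eq_zero_of_ev_eq_zero (by simp)⟩
    have h2 : IsUnit (algebraMap k (DualQuot k) (ev k a)) := ha.map _
    have := h1.isUnit_add_left_of_commute h2 (Commute.all _ _)
    rwa [add_sub_cancel] at this

instance : IsLocalRing (DualQuot k) :=
  haveI : IsLocalHom (ev k : DualQuot k →+* k) := ⟨fun a ha => isLocalHom_ev.map_nonunit a ha⟩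
  RingHom.domain_isLocalRing (ev k : DualQuot k →+* k)

theorem mem_maximalIdeal_iff (a : DualQuot k) : a ∈ maximalIdeal (DualQuot k) ↔ ev k a = 0 := by
  rw [mem_maximalIdeal, mem_nonunits_iff, ← isUnit_map_iff (ev k), isUnit_iff_ne_zero, not_not]

theorem mem_maximalIdeal_iff_exists (a : DualQuot k) :
    a ∈ maximalIdeal (DualQuot k) ↔ ∃ d : k, a = d • t k := by
  rw [mem_maximalIdeal_iff]
  constructor
  · intro ha
    obtain ⟨c, d, rfl⟩ := exists_eq a
    rw [ev_eq] at ha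
    exact ⟨d, by rw [ha, map_zero, zero_add]⟩
  · rintro ⟨d, rfl⟩
    simp [ev]

theorem maximalIdeal_sq : maximalIdeal (DualQuot k) ^ 2 = ⊥ := by
  rw [eq_bot_iff, pow_two (maximalIdeal _), Ideal.mul_le]
  intro a ha b hb
  obtain ⟨c, rfl⟩ := (mem_maximalIdeal_iff_exists a).1 ha
  obtain ⟨d, rfl⟩ := (mem_maximalIdeal_iff_exists b).1 hb
  rw [smul_mul_smul_comm, ← pow_two (t k), t_sq, smul_zero]
  exact Submodule.zero_mem _

theorem residue_bijective :
    Function.Bijective ((residue (DualQuot k)).comp (algebraMap k (DualQuot k))) := by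
  refine ⟨RingHom.injective _, fun y => ?_⟩
  obtain ⟨a, rfl⟩ := residue_surjective y
  refine ⟨ev k a, ?_⟩
  rw [RingHom.comp_apply, ← sub_eq_zero, ← map_sub, residue_eq_zero_iff, mem_maximalIdeal_iff]
  simp

theorem isLocalHom {R : Type*} [CommRing R] [Nontrivial R] [Algebra k R]
    (α : DualQuot k →ₐ[k] R) : IsLocalHom α where
  map_nonunit a ha := by
    by_contra h
    have h1 : a ^ 2 = 0 := sq_eq_zero_of_ev_eq_zero
      ((mem_maximalIdeal_iff a).1 ((mem_maximalIdeal a).2 h))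
    have h2 : IsUnit (α a ^ 2) := ha.pow 2
    rw [← map_pow, h1, map_zero] at h2
    exact not_isUnit_zero h2

end DualQuot

end DualNumbers

section SelfExtension

variable {k : Type} [Field k] {Λ : Type} [Ring Λ] [Algebra k Λ] {V : Type} [AddCommGroup V]
  [Module k V] [Module Λ V] [IsScalarTower k Λ V]

namespace ModExtension

variable (E : ModExtension Λ V V)

/-- The nilpotent endomorphism `ι ∘ p` of the middle term of a self-extension. -/
def nilEnd : Module.End Λ E.middle := E.ι ∘ₗ E.p

theorem p_ι (v : V) : E.p (E.ι v) = 0 := (E.exact _).2 ⟨v, rfl⟩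

theorem nilEnd_sq : E.nilEnd ^ 2 = 0 := by
  refine LinearMap.ext fun x => ?_
  rw [pow_two]
  change E.ι (E.p (E.ι (E.p x))) = 0
  rw [E.p_ι, map_zero]

/-- The `k[t]/(t²)`-module structure on the middle term of a self-extension in which `t` acts as
`ι ∘ p`. -/
@[reducible]
noncomputable def dualModule [Module k E.middle] [IsScalarTower k Λ E.middle] :
    Module (DualQuot k) E.middle :=
  Module.compHom E.middle
    (DualQuot.lift (k := k) E.nilEnd E.nilEnd_sq : DualQuot k →+* Module.End Λ E.middle)

section

variable {E} [Module k E.middle] [IsScalarTower k Λ E.middle] [Module (DualQuot k) E.middle]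
  [IsScalarTower k (DualQuot k) E.middle]

theorem dual_smul (ht : ∀ x : E.middle, DualQuot.t k • x = E.ι (E.p x))
    (c d : k) (x : E.middle) :
    (algebraMap k (DualQuot k) c + d • DualQuot.t k) • x = c • x + d • E.ι (E.p x) := by
  rw [add_smul, algebraMap_smul, smul_assoc, ht]

theorem p_dual_smul (ht : ∀ x : E.middle, DualQuot.t k • x = E.ι (E.p x))
    (a : DualQuot k) (x : E.middle) : E.p (a • x) = DualQuot.ev k a • E.p x := by
  obtain ⟨c, d, rfl⟩ := DualQuot.exists_eq a
  rw [dual_smul ht, DualQuot.ev_eq, map_add, LinearMap.map_smul_of_tower,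
    LinearMap.map_smul_of_tower, E.p_ι, smul_zero, add_zero]

theorem p_eq_zero_iff_mem (ht : ∀ x : E.middle, DualQuot.t k • x = E.ι (E.p x))
    (x : E.middle) :
    E.p x = 0 ↔ x ∈ maximalIdeal (DualQuot k) • (⊤ : Submodule (DualQuot k) E.middle) := by
  constructor
  · intro hx
    obtain ⟨v, rfl⟩ := (E.exact x).1 hx
    obtain ⟨y, rfl⟩ := E.p_surjective v
    rw [← ht]
    exact Submodule.smul_mem_smul
      ((DualQuot.mem_maximalIdeal_iff_exists _).2 ⟨1, (one_smul _ _).symm⟩) Submodule.mem_top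
  · intro hx
    refine Submodule.smul_induction_on hx (fun a ha y _ => ?_) fun x y hx hy => ?_
    · rw [p_dual_smul ht, (DualQuot.mem_maximalIdeal_iff a).1 ha, zero_smul]
    · rw [map_add, hx, hy, add_zero]

theorem exists_dual_basis [FiniteDimensional k V]
    (ht : ∀ x : E.middle, DualQuot.t k • x = E.ι (E.p x)) :
    ∃ n : ℕ, Nonempty (Module.Basis (Fin n) (DualQuot k) E.middle) := by
  let b := Module.finBasis k V
  choose m hm using fun i => E.p_surjective (b i)
  refine ⟨_, ⟨Module.Basis.mk (v := m) ?_ ?_⟩⟩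
  · rw [Fintype.linearIndependent_iff]
    intro a ha i
    have hev : ∀ j, DualQuot.ev k (a j) = 0 := by
      refine Fintype.linearIndependent_iff.1 b.linearIndependent _ ?_
      have := congrArg E.p ha
      simpa only [map_sum, map_zero, p_dual_smul ht, hm] using this
    choose d hd using fun j =>
      (DualQuot.mem_maximalIdeal_iff_exists _).1 ((DualQuot.mem_maximalIdeal_iff (a j)).2 (hev j))
    have hd0 : ∀ j, d j = 0 := by
      refine Fintype.linearIndependent_iff.1 b.linearIndependent _ (E.ι_injective ?_)
      rw [map_sum, map_zero, ← ha]
      refine Finset.sum_congr rfl fun j _ => ?_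
      rw [hd, smul_assoc, ht, hm, LinearMap.map_smul_of_tower]
    rw [hd, hd0, zero_smul]
  · intro x _
    have hsum : ∀ c : Fin _ → k,
        ∑ j, c j • m j ∈ Submodule.span (DualQuot k) (Set.range m) := fun c =>
      Submodule.sum_mem _ fun j _ => by
        rw [← algebraMap_smul (DualQuot k)]
        exact Submodule.smul_mem _ _ (Submodule.subset_span ⟨j, rfl⟩)
    have hp : ∀ y, E.p (∑ j, b.repr (E.p y) j • m j) = E.p y := fun y => by
      simp only [map_sum, LinearMap.map_smul_of_tower, hm]
      exact b.sum_repr _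
    obtain ⟨v, hv⟩ := (E.exact (x - ∑ j, b.repr (E.p x) j • m j)).1
      (by rw [map_sub, hp, sub_self])
    obtain ⟨y, rfl⟩ := E.p_surjective v
    rw [← hp y, ← ht] at hv
    rw [← sub_add_cancel x (∑ j, b.repr (E.p x) j • m j), ← hv]
    exact Submodule.add_mem _ (Submodule.smul_mem _ _ (hsum _)) (hsum _)

end

/-- A self-extension of `V`, viewed as a lift of `V` over `k[t]/(t²)`. -/
theorem exists_lift [FiniteDimensional k V] :
    ∃ (U : ModuleLift k Λ V (DualQuot k)) (e : U.carrier ≃ₗ[Λ] E.middle),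
      (∀ x, U.π x = E.p (e x)) ∧ ∀ x, e (DualQuot.t k • x) = E.ι (E.p (e x)) := by
  let : Module k E.middle := Module.compHom E.middle (algebraMap k Λ)
  have : IsScalarTower k Λ E.middle := IsScalarTower.of_algebraMap_smul fun _ _ => rfl
  let := E.dualModule (k := k)
  have ht : ∀ x : E.middle, DualQuot.t k • x = E.ι (E.p x) := fun x => by
    change DualQuot.lift E.nilEnd E.nilEnd_sq (DualQuot.t k) x = _
    rw [DualQuot.lift_t]
    rfl
  have : IsScalarTower k (DualQuot k) E.middle := ⟨fun c a x => by
    change DualQuot.lift E.nilEnd E.nilEnd_sq (c • a) x = c • DualQuot.lift E.nilEnd E.nilEnd_sq a x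
    rw [map_smul, LinearMap.smul_apply]⟩
  have : SMulCommClass (DualQuot k) Λ E.middle := ⟨fun a l x =>
    map_smul (DualQuot.lift (k := k) E.nilEnd E.nilEnd_sq a) l x⟩
  obtain ⟨n, ⟨b⟩⟩ := exists_dual_basis ht
  have : Module.Finite (DualQuot k) E.middle := Module.Finite.of_basis b
  have : Module.Free (DualQuot k) E.middle := Module.Free.of_basis b
  exact ⟨{ carrier := E.middle
           π := E.p
           π_surjective := E.p_surjective
           π_ker := p_eq_zero_iff_mem ht }, LinearEquiv.refl Λ _, fun _ => rfl, ht⟩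

end ModExtension

theorem ModuleLift.span_range_eq_top {R : Type} [CommRing R] [Algebra k R] [IsLocalRing R]
    (L : ModuleLift k Λ V R) {M : Type*} (g : M → L.carrier)
    (hg : Function.Surjective (L.π ∘ g)) : Submodule.span R (Set.range g) = ⊤ := by
  refine top_le_iff.1 (Submodule.le_of_le_smul_of_le_jacobson_bot Module.Finite.fg_top
    (IsLocalRing.maximalIdeal_le_jacobson ⊥) fun y _ => ?_)
  obtain ⟨m, hm⟩ := hg (L.π y)
  rw [← add_sub_cancel (g m) y]
  refine Submodule.add_mem_sup (Submodule.subset_span ⟨m, rfl⟩) ((L.π_ker _).1 ?_)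
  rw [map_sub, sub_eq_zero]
  exact hm.symm

theorem ModuleLift.eq_zero_of_smul_eq_zero [Nontrivial V] {R : Type} [CommRing R] [Algebra k R]
    [IsLocalRing R] (L : ModuleLift k Λ V R) {M : Type*} (g : M → L.carrier)
    (hg : Function.Surjective (L.π ∘ g)) {a : R} (ha : ∀ m, a • g m = 0) : a = 0 := by
  have := L.π_surjective.nontrivial
  refine FaithfulSMul.eq_of_smul_eq_smul (α := L.carrier) fun y => ?_
  rw [zero_smul]
  have hle : Submodule.span R (Set.range g) ≤ LinearMap.ker (LinearMap.lsmul R L.carrier a) :=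
    Submodule.span_le.2 (by rintro _ ⟨m, rfl⟩; exact ha m)
  rw [L.span_range_eq_top g hg] at hle
  exact hle (Submodule.mem_top (x := y))

/-- If `Ext¹(M, V) = 0` for the middle term `M` of a non-split self-extension of `V`, then the lift
of `V` over `k[t]/(t²)` defined by this extension is universal. -/
theorem ModExtension.isUniversalLift [IsNoetherianRing Λ] (hEnd : EndIsScalar k Λ V)
    (E : ModExtension Λ V V) (hE : ¬ E.Splits) [Module.Finite Λ E.middle]
    (hExt : ExtVanishes Λ V E.middle) (U : ModuleLift k Λ V (DualQuot k))
    (e : U.carrier ≃ₗ[Λ] E.middle) (hπ : ∀ x, U.π x = E.p (e x))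
    (ht : ∀ x, e (DualQuot.t k • x) = E.ι (E.p (e x))) :
    IsUniversalLift (DualQuot k) U := by
  intro R _ _ _ _ _ _ L
  have := hEnd.nontrivial
  have : SMulCommClass Λ R L.carrier := SMulCommClass.symm _ _ _
  obtain ⟨-, hlift, -⟩ := hExt.hom_reduction L.π L.π_surjective L.π_ker
  obtain ⟨g, hg⟩ := hlift E.p
  have hgp : ∀ x, L.π (g x) = E.p x := LinearMap.congr_fun hg
  have hsurj : Function.Surjective (L.π ∘ g) := fun v => by
    obtain ⟨x, rfl⟩ := E.p_surjective v
    exact ⟨x, hgp x⟩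
  have hgen : ∀ h : E.middle →ₗ[Λ] L.carrier, ∃ r : R, h = r • g :=
    hExt.exists_eq_smul L.π L.π_surjective L.π_ker g fun σ => by
      obtain ⟨c, hc⟩ := E.exists_eq_smul_p hEnd hE σ
      refine ⟨algebraMap k R c, LinearMap.ext fun x => ?_⟩
      change L.π (algebraMap k R c • g x) = σ x
      rw [algebraMap_smul, LinearMap.map_smul_of_tower, hgp, hc]
  obtain ⟨r, hr⟩ := hgen (g ∘ₗ E.nilEnd)
  have hr' : ∀ x, g (E.ι (E.p x)) = r • g x := LinearMap.congr_fun hr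
  have hr2 : r ^ 2 = 0 := by
    refine L.eq_zero_of_smul_eq_zero g hsurj fun x => ?_
    rw [pow_two, mul_smul, ← hr', ← hr', E.p_ι, map_zero, map_zero]
  refine ⟨DualQuot.lift r hr2, ⟨DualQuot.isLocalHom _, ?_⟩, ?_⟩
  · refine ⟨(g ∘ₗ e.toLinearMap).toAddMonoidHom, fun a u => ?_, fun l u => ?_, ?_, fun u => ?_⟩
    · obtain ⟨c, d, rfl⟩ := DualQuot.exists_eq a
      have hgt : (g ∘ₗ e.toLinearMap) (DualQuot.t k • u) = r • (g ∘ₗ e.toLinearMap) u :=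
        (congrArg g (ht u)).trans (hr' (e u))
      change (g ∘ₗ e.toLinearMap) _ = _ • (g ∘ₗ e.toLinearMap) u
      rw [add_smul, algebraMap_smul, smul_assoc, map_add, LinearMap.map_smul_of_tower,
        LinearMap.map_smul_of_tower, hgt, map_add, AlgHom.commutes, map_smul, DualQuot.lift_t,
        add_smul, algebraMap_smul, smul_assoc]
    · exact map_smul (g ∘ₗ e.toLinearMap) l u
    · refine L.span_range_eq_top _ fun v => ?_
      obtain ⟨x, hx⟩ := hsurj v
      exact ⟨e.symm x, by simpa using hx⟩
    · exact (hgp (e u)).trans (hπ u).symm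
  · rintro α ⟨-, g', hg't, hg'Λ, -, hg'π⟩
    refine DualQuot.algHom_ext ?_
    rw [DualQuot.lift_t]
    let g'' : E.middle →ₗ[Λ] L.carrier :=
      { toFun := fun x => g' (e.symm x)
        map_add' := fun x y => by rw [map_add, map_add]
        map_smul' := fun l x => by rw [map_smul, hg'Λ, RingHom.id_apply] }
    have hg''π : ∀ x, L.π (g'' x) = E.p x := fun x => by
      rw [← e.apply_symm_apply x, ← hπ, ← hg'π, e.apply_symm_apply]
      rfl
    have hg''t : ∀ x, g'' (E.ι (E.p x)) = α (DualQuot.t k) • g'' x := fun x => by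
      have h1 : e.symm (E.ι (E.p x)) = DualQuot.t k • e.symm x := by
        rw [LinearEquiv.symm_apply_eq, ht, e.apply_symm_apply]
      exact (congrArg g' h1).trans (hg't _ _)
    obtain ⟨a, ha⟩ := hgen g''
    have ha' : ∀ x, g'' x = a • g x := LinearMap.congr_fun ha
    rw [← sub_eq_zero]
    refine L.eq_zero_of_smul_eq_zero g'' (fun v => ?_) fun x => ?_
    · obtain ⟨x, rfl⟩ := E.p_surjective v
      exact ⟨x, hg''π x⟩
    · rw [sub_smul, ← hg''t, ha', ha', hr', smul_comm, sub_self]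

end SelfExtension

/-- Let `k` be an algebraically closed field, let `Λ` be a
finite-dimensional `k`-algebra, and let `V` be a finitely generated `Λ`-module with
`End_Λ(V) ≅ k` and `dim_k Ext¹_Λ(V,V) = 1`.  Suppose there exists a non-split short exact
sequence `0 → V → M → V → 0` of `Λ`-modules such that `Ext¹_Λ(M,V) = 0` and every
surjective `Λ`-module homomorphism `σ : M → V` has kernel equal to `ι(V)`.
Then `V` has a universal deformation ring and `R(Λ,V) ≅ k[t]/(t²)`. -/
theorem statement_2 (k : Type) [Field k] [IsAlgClosed k]
    (Λ : Type) [Ring Λ] [Algebra k Λ] [FiniteDimensional k Λ]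
    (V : Type) [AddCommGroup V] [Module k V] [Module Λ V] [IsScalarTower k Λ V]
    [Module.Finite Λ V]
    (hEnd : EndIsScalar k Λ V)
    (hExt : ExtSelfOneDimensional k Λ V)
    (E : ModExtension Λ V V) (hE : ¬ E.Splits)
    (hExtMV : ExtVanishes Λ V E.middle)
    (hker : ∀ σ : E.middle →ₗ[Λ] V, Function.Surjective σ →
      ∀ x : E.middle, σ x = 0 ↔ x ∈ Set.range E.ι) :
    IsUniversalDeformationRing k Λ V
      (Polynomial k ⧸ Ideal.span {(Polynomial.X : Polynomial k) ^ 2}) := by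
  have : FiniteDimensional k V := Module.Finite.trans Λ V
  have : IsNoetherianRing Λ := isNoetherian_of_tower k inferInstance
  have : Module.Finite Λ E.middle := by
    have h1 : Module.Finite Λ (LinearMap.range E.ι) :=
      Module.Finite.range E.ι
    have hrange : LinearMap.ker E.p = LinearMap.range E.ι := Submodule.ext E.exact
    have h2 : Module.Finite Λ (E.middle ⧸ LinearMap.range E.ι) := by
      rw [← hrange]
      exact Module.Finite.equiv (E.p.quotKerEquivOfSurjective E.p_surjective).symm
    exact Module.Finite.of_submodule_quotient (LinearMap.range E.ι)
  obtain ⟨U, e, hπ, ht⟩ := E.exists_lift (k := k)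
  exact
    { isLocalRing := inferInstanceAs (IsLocalRing (DualQuot k))
      isNoetherianRing := inferInstance
      isAdicComplete := isAdicComplete_of_pow_eq_bot _ DualQuot.maximalIdeal_sq
      residue_bijective := DualQuot.residue_bijective
      exists_universalLift := ⟨U, E.isUniversalLift hEnd hE hExtMV U e hπ ht⟩ }
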